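/- Let C be a 2×2 complex matrix with det C = 1, and suppose C = P·U is a polar decomposition: P is a Hermitian positive definite 2×2 complex matrix and U is unitary (U·Uᴴ = Uᴴ·U = 1). Then C + (Cᴴ)⁻¹ = (trace P) • U, where trace P is a positive real number; in particular the unitary factor of the polar decomposition equals (trace P)⁻¹ • (C + (Cᴴ)⁻¹). -/

import Mathlib

open Matrix
open scoped ComplexOrder

/-- A `2 × 2` matrix and its adjugate add up to a scalar matrix, the scalar being the trace. -/
theorem Matrix.add_adjugate_fin_two {R : Type*} [CommRing R] (A : Matrix (Fin 2) (Fin 2) R) :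
    A + A.adjugate = A.trace • (1 : Matrix (Fin 2) (Fin 2) R) := by
  rw [adjugate_fin_two]
  ext i j
  fin_cases i <;> fin_cases j <;> simp [trace_fin_two, add_comm]

/-- A positive definite matrix whose product with a unitary matrix has determinant one has
determinant one itself. -/
theorem Matrix.PosDef.det_eq_one_of_det_mul_eq_one {n : Type*} [Fintype n] [DecidableEq n]
    {P U : Matrix n n ℂ} (hP : P.PosDef) (hU : U * Uᴴ = 1) (h : (P * U).det = 1) :
    P.det = 1 := by
  obtain ⟨r, hr, hrP⟩ := RCLike.pos_iff_exists_ofReal.mp hP.det_pos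
  have hUdet : ‖U.det‖ = 1 :=
    CStarRing.norm_of_mem_unitary (det_of_mem_unitary (mem_unitaryGroup_iff.mpr hU))
  have hnorm : ‖P.det‖ = 1 := by
    simpa [det_mul, hUdet] using congrArg norm h
  rw [← hrP, RCLike.norm_ofReal, abs_of_pos hr] at hnorm
  rw [← hrP, hnorm, RCLike.ofReal_one]

/-- If `C ∈ SL₂(ℂ)` has polar decomposition `C = P·U` with `P` Hermitian positive
definite and `U` unitary, then `C + (Cᴴ)⁻¹ = (trace P) • U`, where `trace P` is a
positive real number; in particular the unitary factor is
`(trace P)⁻¹ • (C + (Cᴴ)⁻¹)`. -/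
theorem polar_unitary_part (C P U : Matrix (Fin 2) (Fin 2) ℂ)
    (hdet : C.det = 1) (hC : C = P * U) (hP : P.PosDef)
    (hU₁ : U * Uᴴ = 1) (hU₂ : Uᴴ * U = 1) :
    (∃ r : ℝ, 0 < r ∧ P.trace = (r : ℂ)) ∧
    C + (Cᴴ)⁻¹ = P.trace • U ∧
    U = (P.trace)⁻¹ • (C + (Cᴴ)⁻¹) := by
  subst hC
  have hPdet : P.det = 1 := hP.det_eq_one_of_det_mul_eq_one hU₁ hdet
  have hinv : ((P * U)ᴴ)⁻¹ = P.adjugate * U := by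
    apply inv_eq_right_inv
    rw [conjTranspose_mul, hP.isHermitian.eq, Matrix.mul_assoc, ← Matrix.mul_assoc P,
      mul_adjugate, hPdet, one_smul, Matrix.one_mul, hU₂]
  have hsum : P * U + ((P * U)ᴴ)⁻¹ = P.trace • U := by
    rw [hinv, ← Matrix.add_mul, add_adjugate_fin_two, Matrix.smul_mul, Matrix.one_mul]
  obtain ⟨r, hr, hrP⟩ := RCLike.pos_iff_exists_ofReal.mp hP.trace_pos
  refine ⟨⟨r, hr, hrP.symm⟩, hsum, ?_⟩
  rw [hsum, inv_smul_smul₀ hP.trace_pos.ne']
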